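/- A smooth complex structure S : U → M₂(ℍ) (S² = −E₂) is harmonic, i.e. ∂ₓA_x + ∂_yA_y = 0 on U, if and only if for every λ ∈ ℂ* the connection d^λ = d + ω^λ is flat, i.e. the curvature R^λ = ∂ₓω^λ_y − ∂_yω^λ_x + ω^λ_x∘ω^λ_y − ω^λ_y∘ω^λ_x vanishes identically on U. -/

import Mathlib

/- STATEMENT 8: A smooth complex structure `S : U → M₂(ℍ)` (`S² = −E₂`) is harmonic,
i.e. `∂ₓA_x + ∂_yA_y = 0` on `U`, if and only if for every `λ ∈ ℂ*` the connection
`d^λ = d + ω^λ` is flat, i.e. the curvature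
`R^λ = ∂ₓω^λ_y − ∂_yω^λ_x + ω^λ_x∘ω^λ_y − ω^λ_y∘ω^λ_x` vanishes identically on `U`. -/

open Matrix Quaternion

noncomputable section

attribute [local instance] Matrix.normedAddCommGroup Matrix.normedSpace

abbrev Hq : Type := ℍ[ℝ]
abbrev M2 : Type := Matrix (Fin 2) (Fin 2) Hq

/-- the standard embedding ℂ → ℍ (with `span_ℝ{1,i} = ℂ ⊂ ℍ`) -/
def cq (z : ℂ) : Hq := ⟨z.re, z.im, 0, 0⟩
/-- the quaternion `i` -/
def qi : Hq := ⟨0, 1, 0, 0⟩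

/-- Hopf field component `A_x = ¼(∂_yS + S∂ₓS)` -/
def Ax (S Sx Sy : ℝ × ℝ → M2) (p : ℝ × ℝ) : M2 := (4 : ℝ)⁻¹ • (Sy p + S p * Sx p)
/-- Hopf field component `A_y = ¼(−∂ₓS + S∂_yS)` -/
def Ay (S Sx Sy : ℝ × ℝ → M2) (p : ℝ × ℝ) : M2 := (4 : ℝ)⁻¹ • (-Sx p + S p * Sy p)

/-- connection form `ω^λ_x(v) = ½(A_x v − (A_y v)i)(λ−1) + ½(A_x v + (A_y v)i)(λ⁻¹−1)` -/
def omx (S Sx Sy : ℝ × ℝ → M2) (l : ℂ) (p : ℝ × ℝ) (v : Fin 2 → Hq) : Fin 2 → Hq :=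
  fun n =>
    ((2 : ℝ)⁻¹ • ((Ax S Sx Sy p *ᵥ v) n - (Ay S Sx Sy p *ᵥ v) n * qi)) * cq (l - 1) +
    ((2 : ℝ)⁻¹ • ((Ax S Sx Sy p *ᵥ v) n + (Ay S Sx Sy p *ᵥ v) n * qi)) * cq (l⁻¹ - 1)

/-- connection form `ω^λ_y(v) = ½(A_y v + (A_x v)i)(λ−1) + ½(A_y v − (A_x v)i)(λ⁻¹−1)` -/
def omy (S Sx Sy : ℝ × ℝ → M2) (l : ℂ) (p : ℝ × ℝ) (v : Fin 2 → Hq) : Fin 2 → Hq :=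
  fun n =>
    ((2 : ℝ)⁻¹ • ((Ay S Sx Sy p *ᵥ v) n + (Ax S Sx Sy p *ᵥ v) n * qi)) * cq (l - 1) +
    ((2 : ℝ)⁻¹ • ((Ay S Sx Sy p *ᵥ v) n - (Ax S Sx Sy p *ᵥ v) n * qi)) * cq (l⁻¹ - 1)

@[simp] theorem cq_re (z : ℂ) : (cq z).re = z.re := rfl
@[simp] theorem cq_imI (z : ℂ) : (cq z).imI = z.im := rfl
@[simp] theorem cq_imJ (z : ℂ) : (cq z).imJ = 0 := rfl
@[simp] theorem cq_imK (z : ℂ) : (cq z).imK = 0 := rfl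
@[simp] theorem qi_re : qi.re = 0 := rfl
@[simp] theorem qi_imI : qi.imI = 1 := rfl
@[simp] theorem qi_imJ : qi.imJ = 0 := rfl
@[simp] theorem qi_imK : qi.imK = 0 := rfl

theorem cq_mul (z w : ℂ) : cq (z * w) = cq z * cq w := by
  ext <;> simp

theorem cq_add (z w : ℂ) : cq (z + w) = cq z + cq w := by
  ext <;> simp

/-- the coefficient of `A_x` in `ω^λ_x` -/
def coefC (l : ℂ) : ℂ := (l + l⁻¹) / 2 - 1

/-- the coefficient of `A_x` in `ω^λ_y` -/
def coefS (l : ℂ) : ℂ := Complex.I * (l - l⁻¹) / 2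

theorem coef_relation {l : ℂ} (hl : l ≠ 0) :
    coefC l * coefC l + coefS l * coefS l = -2 * coefC l := by
  unfold coefC coefS
  field_simp
  ring_nf
  simp only [Complex.I_sq]
  ring

theorem combine_coef (a b : Hq) (l : ℂ) :
    ((2 : ℝ)⁻¹ • (a - b * qi)) * cq (l - 1) + ((2 : ℝ)⁻¹ • (a + b * qi)) * cq (l⁻¹ - 1) =
      a * cq (coefC l) - b * cq (coefS l) := by
  have hc : coefC l = ((2⁻¹ : ℝ) : ℂ) * ((l - 1) + (l⁻¹ - 1)) := by
    unfold coefC; push_cast; ring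
  have hs : coefS l = ((2⁻¹ : ℝ) : ℂ) * (Complex.I * ((l - 1) - (l⁻¹ - 1))) := by
    unfold coefS; push_cast; ring
  rw [hc, hs]
  generalize l - 1 = z
  generalize l⁻¹ - 1 = w
  ext <;> simp <;> ring

open MulOpposite in
theorem omx_eq (S Sx Sy : ℝ × ℝ → M2) (l : ℂ) (p : ℝ × ℝ) (v : Fin 2 → Hq) :
    omx S Sx Sy l p v =
      Ax S Sx Sy p *ᵥ (op (cq (coefC l)) • v) - Ay S Sx Sy p *ᵥ (op (cq (coefS l)) • v) := by
  funext n
  simp only [omx, mulVec_smul, Pi.sub_apply, Pi.smul_apply, op_smul_eq_mul]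
  exact combine_coef _ _ l

open MulOpposite in
theorem omy_eq (S Sx Sy : ℝ × ℝ → M2) (l : ℂ) (p : ℝ × ℝ) (v : Fin 2 → Hq) :
    omy S Sx Sy l p v =
      Ay S Sx Sy p *ᵥ (op (cq (coefC l)) • v) + Ax S Sx Sy p *ᵥ (op (cq (coefS l)) • v) := by
  funext n
  simp only [omy, mulVec_smul, Pi.add_apply, Pi.smul_apply, op_smul_eq_mul]
  have h := combine_coef ((Ay S Sx Sy p *ᵥ v) n) (-(Ax S Sx Sy p *ᵥ v) n) l
  simpa only [neg_mul, sub_neg_eq_add, ← sub_eq_add_neg] using h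

theorem HasDerivAt.matrix_mul_quaternion {A B : ℝ → M2} {A' B' : M2} {t : ℝ}
    (hA : HasDerivAt A A' t) (hB : HasDerivAt B B' t) :
    HasDerivAt (fun s => A s * B s) (A' * B t + A t * B') t := by
  refine hasDerivAt_pi.2 fun i => hasDerivAt_pi.2 fun j => ?_
  have hA' := fun k => hasDerivAt_pi.1 (hasDerivAt_pi.1 hA i) k
  have hB' := fun k => hasDerivAt_pi.1 (hasDerivAt_pi.1 hB k) j
  have h := HasDerivAt.fun_sum (u := Finset.univ) fun k _ => (hA' k).mul (hB' k)
  simpa [Matrix.mul_apply, Finset.sum_add_distrib] using h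

theorem HasDerivAt.mulVec_quaternion {A : ℝ → M2} {A' : M2} {t : ℝ}
    (hA : HasDerivAt A A' t) (v : Fin 2 → Hq) :
    HasDerivAt (fun s => A s *ᵥ v) (A' *ᵥ v) t := by
  refine hasDerivAt_pi.2 fun i => ?_
  have hA' := fun k => hasDerivAt_pi.1 (hasDerivAt_pi.1 hA i) k
  have h := HasDerivAt.fun_sum (u := Finset.univ) fun k _ => (hA' k).mul_const (v k)
  simpa [Matrix.mulVec, dotProduct] using h

/-- The partial derivatives of a smooth function of two variables are differentiable, with
equal mixed second derivatives. -/
theorem exists_second_partials {E : Type*} [NormedAddCommGroup E] [NormedSpace ℝ E]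
    {U : Set (ℝ × ℝ)} (hU : IsOpen U) {f fx fy : ℝ × ℝ → E}
    (hf : ContDiffOn ℝ (⊤ : ℕ∞) f U)
    (hfx : ∀ p ∈ U, HasDerivAt (fun t => f (t, p.2)) (fx p) p.1)
    (hfy : ∀ p ∈ U, HasDerivAt (fun t => f (p.1, t)) (fy p) p.2)
    {p : ℝ × ℝ} (hp : p ∈ U) :
    ∃ fxx fxy fyy : E,
      HasDerivAt (fun t => fx (t, p.2)) fxx p.1 ∧ HasDerivAt (fun t => fx (p.1, t)) fxy p.2 ∧
      HasDerivAt (fun t => fy (t, p.2)) fxy p.1 ∧ HasDerivAt (fun t => fy (p.1, t)) fyy p.2 := by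
  have hx (q : ℝ × ℝ) : HasDerivAt (fun t : ℝ => (t, q.2)) ((1, 0) : ℝ × ℝ) q.1 :=
    (hasDerivAt_id q.1).prodMk (hasDerivAt_const _ _)
  have hy (q : ℝ × ℝ) : HasDerivAt (fun t : ℝ => (q.1, t)) ((0, 1) : ℝ × ℝ) q.2 :=
    (hasDerivAt_const _ _).prodMk (hasDerivAt_id q.2)
  have hd : ∀ q ∈ U, HasFDerivAt f (fderiv ℝ f q) q := fun q hq =>
    ((hf.contDiffAt (hU.mem_nhds hq)).differentiableAt (by simp)).hasFDerivAt
  have ex : ∀ q ∈ U, fderiv ℝ f q (1, 0) = fx q := fun q hq =>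
    ((hd q hq).comp_hasDerivAt q.1 (hx q)).unique (hfx q hq)
  have ey : ∀ q ∈ U, fderiv ℝ f q (0, 1) = fy q := fun q hq =>
    ((hd q hq).comp_hasDerivAt q.2 (hy q)).unique (hfy q hq)
  have hfp := hf.contDiffAt (hU.mem_nhds hp)
  have hsymm : IsSymmSndFDerivAt ℝ f p := hfp.isSymmSndFDerivAt (by simp; norm_cast)
  have hD : HasFDerivAt (fderiv ℝ f) (fderiv ℝ (fderiv ℝ f) p) p :=
    ((hfp.fderiv_right (m := 1) (by norm_cast)).differentiableAt (by simp)).hasFDerivAt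
  have hev (w : ℝ × ℝ) (g : ℝ × ℝ → E) (hg : ∀ q ∈ U, fderiv ℝ f q w = g q) :
      HasFDerivAt g ((fderiv ℝ (fderiv ℝ f) p).flip w) p := by
    refine HasFDerivAt.congr_of_eventuallyEq (f := fun q => fderiv ℝ f q w) ?_ ?_
    · simpa using hD.clm_apply (hasFDerivAt_const w p)
    · filter_upwards [hU.mem_nhds hp] with q hq using (hg q hq).symm
  have hgx := hev _ _ ex
  have hgy := hev _ _ ey
  refine ⟨_, _, _, hgx.comp_hasDerivAt p.1 (hx p), hgx.comp_hasDerivAt p.2 (hy p), ?_,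
    hgy.comp_hasDerivAt p.2 (hy p)⟩
  have h := hgy.comp_hasDerivAt p.1 (hx p)
  simpa [Function.comp_def, hsymm.eq (0, 1) (1, 0)] using h

/-- A complex structure anticommutes with its derivative. -/
theorem anticomm_of_hasDerivAt {J : ℝ → M2} {J' : M2} {t : ℝ} (hJ : HasDerivAt J J' t)
    (hsq : ∀ᶠ s in nhds t, J s * J s = -1) : J' * J t = -(J t * J') := by
  have h := (hJ.matrix_mul_quaternion hJ).unique
    ((hasDerivAt_const t (-1 : M2)).congr_of_eventuallyEq hsq)
  exact eq_neg_of_add_eq_zero_left h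

/-- With `H = ∂ₓA_x + ∂_yA_y`, one has `∂ₓA_y - ∂_yA_x = S H + 2 [A_x, A_y]`. -/
theorem hopf_structure_equation {R : Type*} [Ring R] [Algebra ℝ R] {J X Y XX XY YY : R}
    (hJ : J * J = -1) (hX : X * J = -(J * X)) (hY : Y * J = -(J * Y)) :
    (4 : ℝ)⁻¹ • (-XX + (X * Y + J * XY)) - (4 : ℝ)⁻¹ • (YY + (Y * X + J * XY)) =
      J * ((4 : ℝ)⁻¹ • (XY + (X * X + J * XX)) + (4 : ℝ)⁻¹ • (-XY + (Y * Y + J * YY))) +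
      (2 : ℝ) • (((4 : ℝ)⁻¹ • (Y + J * X)) * ((4 : ℝ)⁻¹ • (-X + J * Y)) -
        ((4 : ℝ)⁻¹ • (-X + J * Y)) * ((4 : ℝ)⁻¹ • (Y + J * X))) := by
  have hJ' (Z : R) : J * (J * Z) = -Z := by rw [← mul_assoc, hJ, neg_one_mul]
  have hX' (Z : R) : X * (J * Z) = -(J * (X * Z)) := by rw [← mul_assoc, hX, neg_mul, mul_assoc]
  have hY' (Z : R) : Y * (J * Z) = -(J * (Y * Z)) := by rw [← mul_assoc, hY, neg_mul, mul_assoc]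
  simp only [mul_add, add_mul, mul_smul_comm, smul_mul_assoc, mul_neg, neg_mul, mul_assoc, hJ',
    hX', hY', neg_neg]
  module

open MulOpposite in
/-- The commutator part of the curvature. -/
theorem commutator_connection {l : ℂ} (hl : l ≠ 0) (S Sx Sy : ℝ × ℝ → M2) (p : ℝ × ℝ)
    (v : Fin 2 → Hq) :
    omx S Sx Sy l p (omy S Sx Sy l p v) - omy S Sx Sy l p (omx S Sx Sy l p v) =
      -((2 : ℝ) • (Ax S Sx Sy p * Ay S Sx Sy p - Ay S Sx Sy p * Ax S Sx Sy p)) *ᵥ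
        (op (cq (coefC l)) • v) := by
  have hcs : cq (coefC l) * cq (coefS l) = cq (coefS l) * cq (coefC l) := by
    rw [← cq_mul, ← cq_mul, mul_comm]
  have hrel : cq (coefC l) * cq (coefC l) + cq (coefS l) * cq (coefS l) =
      -(cq (coefC l) + cq (coefC l)) := by
    rw [← cq_mul, ← cq_mul, ← cq_add, coef_relation hl, neg_mul, two_mul]
    ext <;> simp
  simp only [omx_eq, omy_eq]
  generalize Ax S Sx Sy p = A
  generalize Ay S Sx Sy p = B
  generalize cq (coefC l) = c at *
  generalize cq (coefS l) = s at *
  have hv : op s • op s • v = -(op c • v + op c • v) - op c • op c • v := by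
    funext n
    have := congrArg (v n * ·) hrel
    simp only [mul_add, mul_neg] at this
    simp only [Pi.smul_apply, Pi.sub_apply, Pi.neg_apply, Pi.add_apply, op_smul_eq_mul, mul_assoc]
    rw [← this]; abel
  have hsc : op s • op c • v = op c • op s • v := by
    simp only [smul_smul, ← op_mul, hcs]
  simp only [← mulVec_smul, smul_add, smul_sub, mulVec_add, mulVec_sub, mulVec_mulVec, hv, hsc,
    neg_mulVec, two_smul, add_mulVec, sub_mulVec, mulVec_neg]
  abel

open MulOpposite in
theorem harmonic_iff_coef {J H : M2} (hJ : J * J = -1) :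
    H = 0 ↔ ∀ l : ℂ, l ≠ 0 → ∀ v : Fin 2 → Hq,
      (J * H) *ᵥ (op (cq (coefC l)) • v) + H *ᵥ (op (cq (coefS l)) • v) = 0 := by
  constructor
  · rintro rfl l - v
    simp
  · intro h
    have hc : op (cq (coefC (-1))) ≠ 0 := fun h0 => by
      have := congrArg (fun q => q.unop.re) h0
      norm_num [coefC] at this
    have hs : cq (coefS (-1)) = 0 := by
      ext <;> simp [coefS]
    have hJH : J * H = 0 := by
      refine Matrix.ext_of_mulVec_single fun i => ?_
      have := h (-1) (by simp) (Pi.single i 1)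
      rw [hs, op_zero, zero_smul, mulVec_zero, add_zero, mulVec_smul] at this
      rw [zero_mulVec]
      exact (smul_eq_zero.1 this).resolve_left hc
    have : J * (J * H) = -H := by rw [← mul_assoc, hJ, neg_one_mul]
    rw [hJH, mul_zero] at this
    exact neg_eq_zero.1 this.symm

theorem stmt8
    (U : Set (ℝ × ℝ)) (hU : IsOpen U)
    (S Sx Sy : ℝ × ℝ → M2)
    (hSsm : ContDiffOn ℝ (⊤ : ℕ∞) S U)
    (hSx : ∀ p ∈ U, HasDerivAt (fun t => S (t, p.2)) (Sx p) p.1)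
    (hSy : ∀ p ∈ U, HasDerivAt (fun t => S (p.1, t)) (Sy p) p.2)
    (hS2 : ∀ p ∈ U, S p * S p = -1)
    -- the partial derivatives ∂ₓA_x and ∂_yA_y
    (Axx Ayy : ℝ × ℝ → M2)
    (hAxx : ∀ p ∈ U, HasDerivAt (fun t => Ax S Sx Sy (t, p.2)) (Axx p) p.1)
    (hAyy : ∀ p ∈ U, HasDerivAt (fun t => Ay S Sx Sy (p.1, t)) (Ayy p) p.2)
    -- the partial derivatives ∂ₓω^λ_y and ∂_yω^λ_x
    (Dxwy Dywx : ℂ → (ℝ × ℝ) → (Fin 2 → Hq) → (Fin 2 → Hq))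
    (hDxwy : ∀ l : ℂ, l ≠ 0 → ∀ p ∈ U, ∀ v,
      HasDerivAt (fun t => omy S Sx Sy l (t, p.2) v) (Dxwy l p v) p.1)
    (hDywx : ∀ l : ℂ, l ≠ 0 → ∀ p ∈ U, ∀ v,
      HasDerivAt (fun t => omx S Sx Sy l (p.1, t) v) (Dywx l p v) p.2) :
    -- S is harmonic ↔ d^λ is flat for all λ ∈ ℂ*
    (∀ p ∈ U, Axx p + Ayy p = 0) ↔
      (∀ l : ℂ, l ≠ 0 → ∀ p ∈ U, ∀ v : Fin 2 → Hq,
        Dxwy l p v - Dywx l p v + omx S Sx Sy l p (omy S Sx Sy l p v)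
          - omy S Sx Sy l p (omx S Sx Sy l p v) = 0) := by
  rw [forall₂_congr fun p hp => harmonic_iff_coef (hS2 p hp)]
  have key : ∀ p ∈ U, ∀ l : ℂ, l ≠ 0 → ∀ v : Fin 2 → Hq,
      Dxwy l p v - Dywx l p v + omx S Sx Sy l p (omy S Sx Sy l p v)
          - omy S Sx Sy l p (omx S Sx Sy l p v) =
        (S p * (Axx p + Ayy p)) *ᵥ (MulOpposite.op (cq (coefC l)) • v) +
          (Axx p + Ayy p) *ᵥ (MulOpposite.op (cq (coefS l)) • v) := by
    intro p hp l hl v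
    obtain ⟨Sxx, Sxy, Syy, hxx, hxy, hyx, hyy⟩ := exists_second_partials hU hSsm hSx hSy hp
    have hUx : ∀ᶠ t in nhds p.1, (t, p.2) ∈ U :=
      (Continuous.prodMk_left p.2).continuousAt.preimage_mem_nhds (hU.mem_nhds hp)
    have hUy : ∀ᶠ t in nhds p.2, (p.1, t) ∈ U :=
      (Continuous.prodMk_right p.1).continuousAt.preimage_mem_nhds (hU.mem_nhds hp)
    have hXJ := anticomm_of_hasDerivAt (hSx p hp) (hUx.mono fun t ht => hS2 _ ht)
    have hYJ := anticomm_of_hasDerivAt (hSy p hp) (hUy.mono fun t ht => hS2 _ ht)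
    have hAxx' := (hAxx p hp).unique
      ((hyx.add ((hSx p hp).matrix_mul_quaternion hxx)).const_smul (4 : ℝ)⁻¹)
    have hAyy' := (hAyy p hp).unique
      ((hxy.neg.add ((hSy p hp).matrix_mul_quaternion hyy)).const_smul (4 : ℝ)⁻¹)
    have hAyx : HasDerivAt (fun t => Ay S Sx Sy (t, p.2)) _ p.1 :=
      (hxx.neg.add ((hSx p hp).matrix_mul_quaternion hyx)).const_smul (4 : ℝ)⁻¹
    have hAxy : HasDerivAt (fun t => Ax S Sx Sy (p.1, t)) _ p.2 :=
      (hyy.add ((hSy p hp).matrix_mul_quaternion hxy)).const_smul (4 : ℝ)⁻¹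
    have hstr := hopf_structure_equation (XX := Sxx) (XY := Sxy) (YY := Syy) (hS2 p hp) hXJ hYJ
    have hwy := hDxwy l hl p hp v
    simp only [omy_eq] at hwy
    have hwx := hDywx l hl p hp v
    simp only [omx_eq] at hwx
    have ewy := hwy.unique ((hAyx.mulVec_quaternion _).add ((hAxx p hp).mulVec_quaternion _))
    have ewx := hwx.unique ((hAxy.mulVec_quaternion _).sub ((hAyy p hp).mulVec_quaternion _))
    rw [add_sub_assoc, commutator_connection hl, ewy, ewx]
    rw [← hAxx', ← hAyy', sub_eq_iff_eq_add] at hstr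
    simp only [Prod.mk.eta] at *
    rw [hstr]
    simp only [Ax, Ay, add_mulVec, neg_mulVec]
    abel
  constructor
  · intro h l hl p hp v
    rw [key p hp l hl v]
    exact h p hp l hl v
  · intro h p hp l hl v
    rw [← key p hp l hl v]
    exact h l hl p hp v
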